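/- arXiv:1707.06350 — 15 statements merged into one kernel-verified Lean document; each statement's English description precedes it below -/
import Mathlib

section
/- Let B > 0, let Γ1 ≥ Γ2 > 0, let q > 0, and define Λ = (−(Γ1+Γ2) + √((Γ1+Γ2)² + 4·Γ1·Γ2²·q)) / (2·Γ1·Γ2). Then 0 ≤ Λ ≤ q/2, and for every p with 0 ≤ p ≤ q/2 one has min(R1(p), R2(p)) ≤ min(R1(Λ), R2(Λ)); that is, Λ maximizes the minimum of the two users' rates over [0, q/2]. -/
/-- Maximin fairness on one channel: Λ maximizes min(R1(p), R2(p)) over [0, q/2]. -/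
theorem stmt_0 (B Γ1 Γ2 q Λ : ℝ) (hB : 0 < B) (hΓ2 : 0 < Γ2) (hΓ : Γ2 ≤ Γ1) (hq : 0 < q)
    (hΛ : Λ = (-(Γ1 + Γ2) + Real.sqrt ((Γ1 + Γ2)^2 + 4*Γ1*Γ2^2*q)) / (2*Γ1*Γ2)) :
    (0 ≤ Λ ∧ Λ ≤ q/2) ∧
    ∀ p : ℝ, 0 ≤ p → p ≤ q/2 →
      min (B * Real.log (1 + p*Γ1)) (B * Real.log ((q*Γ2 + 1)/(p*Γ2 + 1))) ≤
      min (B * Real.log (1 + Λ*Γ1)) (B * Real.log ((q*Γ2 + 1)/(Λ*Γ2 + 1))) := by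
  have hΓ1 : 0 < Γ1 := lt_of_lt_of_le hΓ2 hΓ
  have hD : 0 ≤ (Γ1 + Γ2)^2 + 4*Γ1*Γ2^2*q := by positivity
  have hs := Real.sq_sqrt hD
  have hge : Γ1 + Γ2 ≤ Real.sqrt ((Γ1 + Γ2)^2 + 4*Γ1*Γ2^2*q) := by
    apply Real.le_sqrt_of_sq_le
    have : 0 ≤ 4*Γ1*Γ2^2*q := by positivity
    linarith
  have h0 : 0 ≤ Λ := by
    rw [hΛ]
    apply div_nonneg
    · linarith
    · positivity
  have hsq : Real.sqrt ((Γ1 + Γ2)^2 + 4*Γ1*Γ2^2*q) = 2*Γ1*Γ2*Λ + (Γ1 + Γ2) := by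
    rw [hΛ]
    field_simp
    ring
  rw [hsq] at hs
  have hroot : Γ1*Γ2*Λ^2 + (Γ1+Γ2)*Λ - Γ2*q = 0 := by
    have h : (4*Γ1*Γ2) * (Γ1*Γ2*Λ^2 + (Γ1+Γ2)*Λ - Γ2*q) = 0 := by linarith
    rcases mul_eq_zero.mp h with h | h
    · exact absurd h (by positivity)
    · exact h
  have hle : Λ ≤ q/2 := by
    have h1 : 0 ≤ Γ1*Γ2*Λ^2 := by positivity
    have h2 : Γ2*Λ ≤ Γ1*Λ := mul_le_mul_of_nonneg_right hΓ h0
    have h3 : Γ2*(2*Λ) ≤ Γ2*q := by linarith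
    have := le_of_mul_le_mul_left h3 hΓ2
    linarith
  have hb : 0 < Λ*Γ2 + 1 := by positivity
  have heq : (q*Γ2 + 1)/(Λ*Γ2 + 1) = 1 + Λ*Γ1 := by
    rw [div_eq_iff hb.ne']
    linarith
  refine ⟨⟨h0, hle⟩, fun p hp0 _ => ?_⟩
  rcases le_total p Λ with h | h
  · rw [heq, min_self]
    apply (min_le_left _ _).trans
    gcongr
  · rw [← heq, min_self]
    apply (min_le_right _ _).trans
    gcongr
end

section
/- Let B > 0, let Γ1 ≥ Γ2 > 0, let q > 0, and define Λ = (−(Γ1+Γ2) + √((Γ1+Γ2)² + 4·Γ1·Γ2²·q)) / (2·Γ1·Γ2). Then for every p with 0 ≤ p ≤ q, one has R1(p) ≥ R2(p) if and only if p ≥ Λ. -/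
/-- On [0, q], R1(p) ≥ R2(p) iff p ≥ Λ. -/
theorem stmt_1 (B Γ1 Γ2 q Λ : ℝ) (hB : 0 < B) (hΓ2 : 0 < Γ2) (hΓ : Γ2 ≤ Γ1) (hq : 0 < q)
    (hΛ : Λ = (-(Γ1 + Γ2) + Real.sqrt ((Γ1 + Γ2)^2 + 4*Γ1*Γ2^2*q)) / (2*Γ1*Γ2)) :
    ∀ p : ℝ, 0 ≤ p → p ≤ q →
      (B * Real.log ((q*Γ2 + 1)/(p*Γ2 + 1)) ≤ B * Real.log (1 + p*Γ1) ↔ Λ ≤ p) := by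
  intro p hp hpq
  have h1 : 0 < Γ1 := lt_of_lt_of_le hΓ2 hΓ
  have hd : 0 < p*Γ2 + 1 := by positivity
  have hn : 0 < q*Γ2 + 1 := by positivity
  have hm : 0 < 1 + p*Γ1 := by positivity
  have h12 : 0 < Γ1*Γ2 := mul_pos h1 hΓ2
  have hy : 0 ≤ p*(2*Γ1*Γ2) + (Γ1 + Γ2) := by positivity
  rw [mul_le_mul_iff_right₀ hB, Real.log_le_log_iff (div_pos hn hd) hm, div_le_iff₀ hd, hΛ,
    div_le_iff₀ (by positivity), neg_add_le_iff_le_add, add_comm (Γ1 + Γ2), Real.sqrt_le_left hy]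
  have key : (p*(2*Γ1*Γ2) + (Γ1 + Γ2))^2 - ((Γ1 + Γ2)^2 + 4*Γ1*Γ2^2*q)
      = 4*(Γ1*Γ2) * ((1 + p*Γ1)*(p*Γ2 + 1) - (q*Γ2 + 1)) := by ring
  rw [← sub_nonneg, ← sub_nonneg (b := (Γ1 + Γ2)^2 + 4*Γ1*Γ2^2*q), key,
    mul_nonneg_iff_of_pos_left (by positivity)]
end

section
/- Let B > 0, let Γ1 ≥ Γ2 > 0, let q > 0, and define Λ = (−(Γ1+Γ2) + √((Γ1+Γ2)² + 4·Γ1·Γ2²·q)) / (2·Γ1·Γ2). Then R1(Λ) = R2(Λ) = B·log((Γ2 − Γ1 + √((Γ1+Γ2)² + 4·Γ1·Γ2²·q)) / (2·Γ2)); i.e., at the maximin-optimal power split the two users achieve exactly the same rate, given by this closed form. -/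
/-- At the maximin-optimal split the two rates are equal with a closed form. -/
theorem stmt_2 (B Γ1 Γ2 q Λ : ℝ) (hB : 0 < B) (hΓ2 : 0 < Γ2) (hΓ : Γ2 ≤ Γ1) (hq : 0 < q)
    (hΛ : Λ = (-(Γ1 + Γ2) + Real.sqrt ((Γ1 + Γ2)^2 + 4*Γ1*Γ2^2*q)) / (2*Γ1*Γ2)) :
    B * Real.log (1 + Λ*Γ1)
      = B * Real.log ((Γ2 - Γ1 + Real.sqrt ((Γ1 + Γ2)^2 + 4*Γ1*Γ2^2*q)) / (2*Γ2)) ∧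
    B * Real.log ((q*Γ2 + 1)/(Λ*Γ2 + 1))
      = B * Real.log ((Γ2 - Γ1 + Real.sqrt ((Γ1 + Γ2)^2 + 4*Γ1*Γ2^2*q)) / (2*Γ2)) := by
  have h1 : 0 < Γ1 := lt_of_lt_of_le hΓ2 hΓ
  have hnn : 0 ≤ (Γ1 + Γ2)^2 + 4*Γ1*Γ2^2*q := by positivity
  have hS := Real.sq_sqrt hnn
  have hS0 := Real.sqrt_nonneg ((Γ1 + Γ2)^2 + 4*Γ1*Γ2^2*q)
  have hSp : 0 < Real.sqrt ((Γ1 + Γ2)^2 + 4*Γ1*Γ2^2*q) := Real.sqrt_pos.mpr (by positivity)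
  generalize Real.sqrt ((Γ1 + Γ2)^2 + 4*Γ1*Γ2^2*q) = S at *
  have e1 : 1 + Λ*Γ1 = (Γ2 - Γ1 + S) / (2*Γ2) := by
    rw [hΛ]; field_simp; ring
  have e2 : Λ*Γ2 + 1 = (Γ1 - Γ2 + S) / (2*Γ1) := by
    rw [hΛ]; field_simp; ring
  have hpos : 0 < Γ1 - Γ2 + S := by linarith
  have e3 : (q*Γ2 + 1)/(Λ*Γ2 + 1) = (Γ2 - Γ1 + S) / (2*Γ2) := by
    have hne : (Γ1 - Γ2 + S) / (2*Γ1) ≠ 0 := by positivity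
    rw [e2, div_eq_iff hne, div_mul_div_comm, eq_div_iff (by positivity)]
    linear_combination -hS
  rw [e1, e3]
  exact ⟨rfl, rfl⟩
end

section
/- Let Γ1 ≥ Γ2 > 0 and q > 0, and define Λ = (−(Γ1+Γ2) + √((Γ1+Γ2)² + 4·Γ1·Γ2²·q)) / (2·Γ1·Γ2). Then Λ < Γ2·q/(Γ1+Γ2) ≤ q/2. In particular the maximin-optimal power split is strictly unequal (p1 = Λ < q − Λ = p2), i.e., the system is SIC-stable under the maximin fairness criterion. -/
/-- SIC-stability under maximin fairness: Λ < Γ2·q/(Γ1+Γ2) ≤ q/2. -/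
theorem stmt_3 (Γ1 Γ2 q Λ : ℝ) (hΓ2 : 0 < Γ2) (hΓ : Γ2 ≤ Γ1) (hq : 0 < q)
    (hΛ : Λ = (-(Γ1 + Γ2) + Real.sqrt ((Γ1 + Γ2)^2 + 4*Γ1*Γ2^2*q)) / (2*Γ1*Γ2)) :
    Λ < Γ2*q/(Γ1 + Γ2) ∧ Γ2*q/(Γ1 + Γ2) ≤ q/2 := by
  have h1 : 0 < Γ1 := lt_of_lt_of_le hΓ2 hΓ
  have hS : 0 < Γ1 + Γ2 := by positivity
  constructor
  · obtain ⟨x, hx⟩ : ∃ x, x = Γ2*q/(Γ1 + Γ2) := ⟨_, rfl⟩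
    have hx0 : 0 < x := by rw [hx]; positivity
    have hxS : x * (Γ1 + Γ2) = Γ2 * q := by rw [hx]; field_simp
    rw [← hx, hΛ, div_lt_iff₀ (by positivity)]
    have hpos : 0 < (Γ1 * Γ2 * x)^2 := by positivity
    have key : Real.sqrt ((Γ1 + Γ2)^2 + 4*Γ1*Γ2^2*q) < (Γ1 + Γ2) + x * (2*Γ1*Γ2) := by
      rw [Real.sqrt_lt' (by positivity)]
      have e : ((Γ1 + Γ2) + x * (2*Γ1*Γ2))^2
          = (Γ1 + Γ2)^2 + 4*Γ1*Γ2*(x * (Γ1 + Γ2)) + 4 * (Γ1 * Γ2 * x)^2 := by ring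
      rw [e, hxS]
      linarith
    linarith
  · rw [div_le_div_iff₀ hS (by norm_num)]
    nlinarith
end

section
/- Let B > 0 and Γ1 ≥ Γ2 > 0. Then the function f(q) = B·log((Γ2 − Γ1 + √((Γ1+Γ2)² + 4·Γ1·Γ2²·q)) / (2·Γ2)) is concave on the set {q : q ≥ 0}. -/
/-- The optimal per-channel maximin rate is concave in the channel power budget. -/
theorem stmt_4 (B Γ1 Γ2 : ℝ) (hB : 0 < B) (hΓ2 : 0 < Γ2) (hΓ : Γ2 ≤ Γ1) :
    ConcaveOn ℝ (Set.Ici (0:ℝ))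
      (fun q => B * Real.log ((Γ2 - Γ1 + Real.sqrt ((Γ1 + Γ2)^2 + 4*Γ1*Γ2^2*q)) / (2*Γ2))) := by
  have hΓ1 : 0 < Γ1 := lt_of_lt_of_le hΓ2 hΓ
  have hc : 0 < 4*Γ1*Γ2^2 := by positivity
  have hpos : ∀ q : ℝ, 0 ≤ q →
      0 < (Γ2 - Γ1 + Real.sqrt ((Γ1 + Γ2)^2 + 4*Γ1*Γ2^2*q)) / (2*Γ2) := by
    intro q hq
    have h : Γ1 + Γ2 ≤ Real.sqrt ((Γ1 + Γ2)^2 + 4*Γ1*Γ2^2*q) := by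
      apply Real.le_sqrt_of_sq_le
      have := mul_nonneg hc.le hq
      linarith
    apply div_pos <;> linarith
  refine ⟨convex_Ici 0, ?_⟩
  intro x hx y hy a b ha hb hab
  have hx' : 0 ≤ x := hx
  have hy' : 0 ≤ y := hy
  have hlog := strictConcaveOn_log_Ioi.concaveOn.2 (Set.mem_Ioi.2 (hpos x hx'))
    (Set.mem_Ioi.2 (hpos y hy')) ha hb hab
  have hsq := Real.strictConcaveOn_sqrt.concaveOn.2
    (x := (Γ1 + Γ2)^2 + 4*Γ1*Γ2^2*x) (y := (Γ1 + Γ2)^2 + 4*Γ1*Γ2^2*y)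
    (Set.mem_Ici.2 (by positivity)) (Set.mem_Ici.2 (by positivity)) ha hb hab
  simp only [smul_eq_mul] at hlog hsq ⊢
  have e : a * ((Γ1 + Γ2)^2 + 4*Γ1*Γ2^2*x) + b * ((Γ1 + Γ2)^2 + 4*Γ1*Γ2^2*y)
      = (Γ1 + Γ2)^2 + 4*Γ1*Γ2^2*(a*x+b*y) := by
    linear_combination (Γ1 + Γ2)^2 * hab
  rw [e] at hsq
  have hg : a * ((Γ2 - Γ1 + Real.sqrt ((Γ1 + Γ2)^2 + 4*Γ1*Γ2^2*x)) / (2*Γ2))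
      + b * ((Γ2 - Γ1 + Real.sqrt ((Γ1 + Γ2)^2 + 4*Γ1*Γ2^2*y)) / (2*Γ2))
      ≤ (Γ2 - Γ1 + Real.sqrt ((Γ1 + Γ2)^2 + 4*Γ1*Γ2^2*(a*x+b*y))) / (2*Γ2) := by
    rw [← mul_div_assoc, ← mul_div_assoc, ← add_div]
    apply div_le_div_of_nonneg_right _ (by positivity)
    have : a * (Γ2 - Γ1) + b * (Γ2 - Γ1) = Γ2 - Γ1 := by
      linear_combination (Γ2 - Γ1) * hab
    linarith
  have hgp : 0 < a * ((Γ2 - Γ1 + Real.sqrt ((Γ1 + Γ2)^2 + 4*Γ1*Γ2^2*x)) / (2*Γ2))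
      + b * ((Γ2 - Γ1 + Real.sqrt ((Γ1 + Γ2)^2 + 4*Γ1*Γ2^2*y)) / (2*Γ2)) :=
    (convex_Ioi (0:ℝ)) (hpos x hx') (hpos y hy') ha hb hab
  have h := mul_le_mul_of_nonneg_left (hlog.trans (Real.log_le_log hgp hg)) hB.le
  linarith
end

section
/- Let M ≥ 1, let Γ1, Γ2 : Fin M → ℝ satisfy 0 < Γ2(m) ≤ Γ1(m) for all m, let B > 0 and P > 0. Let λ > 0, set X = (∑_m (Γ2(m) − Γ1(m))/(Γ1(m)·Γ2(m))) / (4·∑_m 1/Γ1(m)), Z = X + √(X² + B/(2·λ·∑_m 1/Γ1(m))), and q*(m) = (Z·Γ2(m) + Γ1(m))·(Z − 1)/(Γ1(m)·Γ2(m)). Assume ∑_m q*(m) = P. Then q*(m) ≥ 0 for all m, and for every q : Fin M → ℝ with q(m) ≥ 0 for all m and ∑_m q(m) ≤ P, one has min_{m} f_m(q(m)) ≤ min_{m} f_m(q*(m)); i.e., q* solves the maximin-fairness channel power-budget problem. -/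
/-- The closed-form budgets q* solve the maximin-fairness channel power-budget problem. -/
theorem stmt_5 (M : ℕ) (hM : 1 ≤ M) (Γ1 Γ2 : Fin M → ℝ)
    (hΓ : ∀ m, 0 < Γ2 m ∧ Γ2 m ≤ Γ1 m) (B P lam X Z : ℝ)
    (hB : 0 < B) (hP : 0 < P) (hlam : 0 < lam)
    (hX : X = (∑ m, (Γ2 m - Γ1 m)/(Γ1 m * Γ2 m)) / (4 * ∑ m, 1/Γ1 m))
    (hZ : Z = X + Real.sqrt (X^2 + B/(2*lam*(∑ m, 1/Γ1 m))))
    (qs : Fin M → ℝ)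
    (hqs : ∀ m, qs m = (Z * Γ2 m + Γ1 m) * (Z - 1) / (Γ1 m * Γ2 m))
    (hsum : ∑ m, qs m = P) :
    (∀ m, 0 ≤ qs m) ∧
    ∀ q : Fin M → ℝ, (∀ m, 0 ≤ q m) → (∑ m, q m ≤ P) →
      (⨅ m, B * Real.log ((Γ2 m - Γ1 m +
          Real.sqrt ((Γ1 m + Γ2 m)^2 + 4*(Γ1 m)*(Γ2 m)^2*(q m))) / (2*Γ2 m))) ≤
      (⨅ m, B * Real.log ((Γ2 m - Γ1 m +
          Real.sqrt ((Γ1 m + Γ2 m)^2 + 4*(Γ1 m)*(Γ2 m)^2*(qs m))) / (2*Γ2 m))) := by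
  haveI : Nonempty (Fin M) := ⟨⟨0, hM⟩⟩
  have h1 : ∀ m, 0 < Γ1 m := fun m => lt_of_lt_of_le (hΓ m).1 (hΓ m).2
  have hS : 0 < ∑ m, 1 / Γ1 m :=
    Finset.sum_pos (fun m _ => one_div_pos.mpr (h1 m)) Finset.univ_nonempty
  have hc : 0 < B / (2 * lam * (∑ m, 1 / Γ1 m)) := by positivity
  have hZ0 : 0 < Z := by
    have h : |X| < Real.sqrt (X^2 + B / (2 * lam * (∑ m, 1 / Γ1 m))) := by
      rw [← Real.sqrt_sq_eq_abs]
      exact Real.sqrt_lt_sqrt (sq_nonneg X) (by linarith)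
    have := neg_abs_le X
    rw [hZ]
    linarith
  have hZ1 : 1 < Z := by
    by_contra hcon
    have hle : ∑ m, qs m ≤ 0 := by
      apply Finset.sum_nonpos
      intro m _
      rw [hqs m]
      have a := (hΓ m).1
      have b := h1 m
      apply div_nonpos_of_nonpos_of_nonneg _ (by positivity)
      exact mul_nonpos_of_nonneg_of_nonpos (by positivity) (by linarith)
    linarith
  have hval : ∀ m, (Γ2 m - Γ1 m +
      Real.sqrt ((Γ1 m + Γ2 m)^2 + 4*(Γ1 m)*(Γ2 m)^2*(qs m))) / (2*Γ2 m) = Z := by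
    intro m
    have a := (hΓ m).1
    have b := h1 m
    have e : (Γ1 m + Γ2 m)^2 + 4*(Γ1 m)*(Γ2 m)^2*(qs m)
        = (2 * Z * Γ2 m + (Γ1 m - Γ2 m))^2 := by
      rw [hqs m]
      field_simp
      ring
    have hnn : 0 ≤ 2 * Z * Γ2 m + (Γ1 m - Γ2 m) := by
      have := (hΓ m).2
      have : 0 < 2 * Z * Γ2 m := by positivity
      linarith
    rw [e, Real.sqrt_sq hnn]
    field_simp
    ring
  refine ⟨?_, ?_⟩
  · intro m
    rw [hqs m]
    have a := (hΓ m).1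
    have b := h1 m
    have c : 0 < Z - 1 := by linarith
    positivity
  · intro q hq hqP
    obtain ⟨m, hm⟩ : ∃ m, q m ≤ qs m := by
      by_contra hcon
      push Not at hcon
      have := Finset.sum_lt_sum_of_nonempty (s := Finset.univ) Finset.univ_nonempty
        (fun m _ => hcon m)
      linarith
    simp only [hval, ciInf_const]
    refine le_trans (ciInf_le (Set.finite_range _).bddBelow m) ?_
    have a := (hΓ m).1
    have b := h1 m
    have hqm := hq m
    apply mul_le_mul_of_nonneg_left _ hB.le
    apply Real.log_le_log
    · apply div_pos _ (by positivity)
      have : Γ1 m + Γ2 m ≤ Real.sqrt ((Γ1 m + Γ2 m)^2 + 4*(Γ1 m)*(Γ2 m)^2*(q m)) := by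
        apply Real.le_sqrt_of_sq_le
        have : 0 ≤ 4*(Γ1 m)*(Γ2 m)^2*(q m) := by positivity
        linarith
      linarith
    · rw [← hval m]
      gcongr
end

section
/- Let M ≥ 1, let Γ1, Γ2 : Fin M → ℝ satisfy 0 < Γ2(m) ≤ Γ1(m) for all m, and let B > 0. For λ > 0 set X = (∑_m (Γ2(m) − Γ1(m))/(Γ1(m)·Γ2(m))) / (4·∑_m 1/Γ1(m)), Z(λ) = X + √(X² + B/(2·λ·∑_m 1/Γ1(m))), and q_m(λ) = (Z(λ)·Γ2(m) + Γ1(m))·(Z(λ) − 1)/(Γ1(m)·Γ2(m)). Then for each m the map λ ↦ q_m(λ) is strictly decreasing on (0, ∞). -/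
/-- Each candidate optimal budget q_m(λ) is strictly decreasing in λ on (0, ∞). -/
theorem stmt_7 (M : ℕ) (hM : 1 ≤ M) (Γ1 Γ2 : Fin M → ℝ)
    (hΓ : ∀ m, 0 < Γ2 m ∧ Γ2 m ≤ Γ1 m) (B : ℝ) (hB : 0 < B)
    (X : ℝ) (hX : X = (∑ m, (Γ2 m - Γ1 m)/(Γ1 m * Γ2 m)) / (4 * ∑ m, 1/Γ1 m))
    (Z : ℝ → ℝ)
    (hZ : ∀ lam : ℝ, Z lam = X + Real.sqrt (X^2 + B/(2*lam*(∑ m, 1/Γ1 m)))) :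
    ∀ m, StrictAntiOn (fun lam => (Z lam * Γ2 m + Γ1 m) * (Z lam - 1) / (Γ1 m * Γ2 m))
      (Set.Ioi (0:ℝ)) := by
  intro m a ha b hb hab
  have ha' : 0 < a := ha
  have hb' : 0 < b := hb
  obtain ⟨h2, h21⟩ := hΓ m
  have h1 : 0 < Γ1 m := lt_of_lt_of_le h2 h21
  have hS : 0 < ∑ m, 1/Γ1 m :=
    Finset.sum_pos (fun i _ => one_div_pos.mpr (lt_of_lt_of_le (hΓ i).1 (hΓ i).2))
      ⟨m, Finset.mem_univ m⟩
  generalize (∑ m, 1/Γ1 m) = S at hS hZ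
  have hpos : 0 < Z b := by
    have hq : 0 < B / (2 * b * S) := by positivity
    have h : |X| < Real.sqrt (X^2 + B / (2 * b * S)) := by
      rw [← Real.sqrt_sq_eq_abs]
      exact Real.sqrt_lt_sqrt (sq_nonneg X) (by linarith)
    rw [hZ]
    linarith [neg_abs_le X]
  have hlt : Z b < Z a := by
    rw [hZ, hZ]
    have hq : B / (2 * b * S) < B / (2 * a * S) := by
      apply div_lt_div_of_pos_left hB (by positivity)
      nlinarith
    have hq' : 0 < B / (2 * b * S) := by positivity
    have := Real.sqrt_lt_sqrt (by positivity : 0 ≤ X^2 + B / (2 * b * S))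
      (by linarith : X^2 + B / (2 * b * S) < X^2 + B / (2 * a * S))
    linarith
  have hp : 0 < Γ1 m * Γ2 m := mul_pos h1 h2
  refine div_lt_div_of_pos_right ?_ hp
  have e1 : 0 < Γ2 m * ((Z a - Z b) * (Z a + Z b)) :=
    mul_pos h2 (mul_pos (by linarith) (by linarith))
  have e2 : 0 ≤ (Γ1 m - Γ2 m) * (Z a - Z b) :=
    mul_nonneg (by linarith) (by linarith)
  nlinarith
end

section
/- Let B > 0, let Γ1 > Γ2 > 0, let W1, W2 > 0 satisfy W1 < W2 and W2·Γ2 < W1·Γ1 (i.e., 1 < W2/W1 < Γ1/Γ2), define Ω = (W2·Γ2 − W1·Γ1)/(Γ1·Γ2·(W1 − W2)), and assume q > 2·Ω. Then 0 < Ω < q/2 and for every p with 0 ≤ p ≤ q/2, F(p) ≤ F(Ω), where F(p) = W1·B·log(1 + p·Γ1) + W2·B·log((q·Γ2 + 1)/(p·Γ2 + 1)); i.e., p1 = Ω, p2 = q − Ω maximizes the weighted sum rate on the channel. -/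
/-- Weighted sum rate on one channel: Ω maximizes F over [0, q/2]. -/
theorem stmt_8 (B Γ1 Γ2 W1 W2 Ω q : ℝ) (hB : 0 < B) (hΓ2 : 0 < Γ2) (hΓ : Γ2 < Γ1)
    (hW1 : 0 < W1) (hW2 : 0 < W2) (hW : W1 < W2) (hWΓ : W2*Γ2 < W1*Γ1)
    (hΩ : Ω = (W2*Γ2 - W1*Γ1) / (Γ1*Γ2*(W1 - W2))) (hq : 2*Ω < q) :
    (0 < Ω ∧ Ω < q/2) ∧
    ∀ p : ℝ, 0 ≤ p → p ≤ q/2 →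
      W1*B*Real.log (1 + p*Γ1) + W2*B*Real.log ((q*Γ2 + 1)/(p*Γ2 + 1)) ≤
      W1*B*Real.log (1 + Ω*Γ1) + W2*B*Real.log ((q*Γ2 + 1)/(Ω*Γ2 + 1)) := by
  have hΓ1 : 0 < Γ1 := hΓ2.trans hΓ
  have hd : 0 < Γ1*Γ2*(W2 - W1) := mul_pos (mul_pos hΓ1 hΓ2) (sub_pos.2 hW)
  have hne : Γ1*Γ2*(W1 - W2) ≠ 0 := by
    intro h
    nlinarith
  have hmul : Ω * (Γ1*Γ2*(W1 - W2)) = W2*Γ2 - W1*Γ1 := by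
    rw [hΩ, div_mul_cancel₀ _ hne]
  have hpos : 0 < Ω := by
    rw [hΩ]
    exact div_pos_of_neg_of_neg (by linarith) (by linarith)
  refine ⟨⟨hpos, by linarith⟩, ?_⟩
  intro p hp hpq
  have hap : 0 < 1 + p*Γ1 := by positivity
  have hbp : 0 < p*Γ2 + 1 := by positivity
  have ha : 0 < 1 + Ω*Γ1 := by positivity
  have hb : 0 < Ω*Γ2 + 1 := by positivity
  have hqq : 0 < q := by linarith
  have hc : 0 < q*Γ2 + 1 := by positivity
  have key : W1 * Real.log ((1 + p*Γ1)/(1 + Ω*Γ1)) ≤ W2 * Real.log ((p*Γ2 + 1)/(Ω*Γ2 + 1)) := by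
    have hr : 0 ≤ W1/W2 := by positivity
    have hr1 : 0 ≤ 1 - W1/W2 := by
      rw [sub_nonneg, div_le_one hW2]
      exact hW.le
    have hx : 0 < (1 + p*Γ1)/(1 + Ω*Γ1) := by positivity
    have h := strictConcaveOn_log_Ioi.concaveOn.2 (Set.mem_Ioi.2 hx)
      (Set.mem_Ioi.2 one_pos) hr hr1 (by ring)
    have e : (W1/W2) * ((1 + p*Γ1)/(1 + Ω*Γ1)) + (1 - W1/W2) * 1
        = (p*Γ2 + 1)/(Ω*Γ2 + 1) := by
      field_simp
      linear_combination (p - Ω) * hmul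
    simp only [smul_eq_mul, Real.log_one, mul_zero, add_zero] at h
    rw [e] at h
    have h2 := mul_le_mul_of_nonneg_left h hW2.le
    rwa [← mul_assoc, mul_div_cancel₀ _ hW2.ne'] at h2
  rw [Real.log_div hap.ne' ha.ne', Real.log_div hbp.ne' hb.ne'] at key
  rw [Real.log_div hc.ne' hbp.ne', Real.log_div hc.ne' hb.ne']
  have h3 := mul_le_mul_of_nonneg_left key hB.le
  linarith
end

section
/- Let B > 0, let Γ1 > Γ2 > 0, let W1, W2 > 0 satisfy W1 < W2 and W2·Γ2 < W1·Γ1, define Ω = (W2·Γ2 − W1·Γ1)/(Γ1·Γ2·(W1 − W2)), and assume 0 < q ≤ 2·Ω. Then F(p) = W1·B·log(1 + p·Γ1) + W2·B·log((q·Γ2 + 1)/(p·Γ2 + 1)) is monotonically nondecreasing on [0, q/2], so its maximum over [0, q/2] is attained at p = q/2; i.e., the weighted-sum-rate optimal allocation is the equal split p1 = p2 = q/2 and the channel is not SIC-stable. -/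
/-- If q ≤ 2Ω, the weighted sum rate is nondecreasing on [0, q/2] (equal split optimal). -/
theorem stmt_9 (B Γ1 Γ2 W1 W2 Ω q : ℝ) (hB : 0 < B) (hΓ2 : 0 < Γ2) (hΓ : Γ2 < Γ1)
    (hW1 : 0 < W1) (hW2 : 0 < W2) (hW : W1 < W2) (hWΓ : W2*Γ2 < W1*Γ1)
    (hΩ : Ω = (W2*Γ2 - W1*Γ1) / (Γ1*Γ2*(W1 - W2))) (hq0 : 0 < q) (hq : q ≤ 2*Ω) :
    MonotoneOn (fun p => W1*B*Real.log (1 + p*Γ1) + W2*B*Real.log ((q*Γ2 + 1)/(p*Γ2 + 1)))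
      (Set.Icc (0:ℝ) (q/2)) ∧
    ∀ p ∈ Set.Icc (0:ℝ) (q/2),
      W1*B*Real.log (1 + p*Γ1) + W2*B*Real.log ((q*Γ2 + 1)/(p*Γ2 + 1)) ≤
      W1*B*Real.log (1 + (q/2)*Γ1) + W2*B*Real.log ((q*Γ2 + 1)/((q/2)*Γ2 + 1)) := by
  have hΓ1 : 0 < Γ1 := hΓ2.trans hΓ
  have key : ∀ p, p ≤ q/2 → p * (Γ1*Γ2*(W2 - W1)) ≤ W1*Γ1 - W2*Γ2 := by
    intro p hp
    have hpos : 0 < Γ1*Γ2*(W2 - W1) := mul_pos (mul_pos hΓ1 hΓ2) (sub_pos.2 hW)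
    have h1 : Ω = (W1*Γ1 - W2*Γ2) / (Γ1*Γ2*(W2 - W1)) := by
      rw [hΩ, ← neg_div_neg_eq]
      congr 1 <;> ring
    have h2 : p ≤ (W1*Γ1 - W2*Γ2) / (Γ1*Γ2*(W2 - W1)) := by
      rw [← h1]; linarith
    exact (le_div_iff₀ hpos).1 h2
  have hder : ∀ p, 0 ≤ p → HasDerivAt
      (fun p => W1*B*Real.log (1 + p*Γ1) + W2*B*(Real.log (q*Γ2 + 1) - Real.log (p*Γ2 + 1)))
      (W1*B*(Γ1/(1 + p*Γ1)) + W2*B*(0 - Γ2/(p*Γ2+1))) p := by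
    intro p hp
    have a1 : (1 + p*Γ1) ≠ 0 := by positivity
    have a2 : (p*Γ2 + 1) ≠ 0 := by positivity
    have d1 : HasDerivAt (fun p : ℝ => 1 + p*Γ1) Γ1 p := by
      simpa using ((hasDerivAt_id p).mul_const Γ1).const_add 1
    have d2 : HasDerivAt (fun p : ℝ => p*Γ2 + 1) Γ2 p := by
      simpa using ((hasDerivAt_id p).mul_const Γ2).add_const 1
    exact ((d1.log a1).const_mul (W1*B)).add
      (((hasDerivAt_const p (Real.log (q*Γ2 + 1))).sub (d2.log a2)).const_mul (W2*B))
  have hmono : MonotoneOn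
      (fun p => W1*B*Real.log (1 + p*Γ1) + W2*B*(Real.log (q*Γ2 + 1) - Real.log (p*Γ2 + 1)))
      (Set.Icc (0:ℝ) (q/2)) := by
    apply monotoneOn_of_deriv_nonneg (convex_Icc _ _)
    · intro p hp
      exact (hder p hp.1).continuousAt.continuousWithinAt
    · intro p hp
      rw [interior_Icc] at hp
      exact (hder p hp.1.le).differentiableAt.differentiableWithinAt
    · intro p hp
      rw [interior_Icc] at hp
      rw [(hder p hp.1.le).deriv]
      have hp0 := hp.1
      have e : W1*B*(Γ1/(1 + p*Γ1)) + W2*B*(0 - Γ2/(p*Γ2+1))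
          = B * ((W1*Γ1 - W2*Γ2) - p * (Γ1*Γ2*(W2 - W1))) / ((1 + p*Γ1)*(p*Γ2+1)) := by
        have a1 : (1 + p*Γ1) ≠ 0 := by positivity
        have a2 : (p*Γ2 + 1) ≠ 0 := by positivity
        field_simp
        ring
      rw [e]
      have := sub_nonneg.2 (key p hp.2.le)
      positivity
  have hM : MonotoneOn
      (fun p => W1*B*Real.log (1 + p*Γ1) + W2*B*Real.log ((q*Γ2 + 1)/(p*Γ2 + 1)))
      (Set.Icc (0:ℝ) (q/2)) := by
    refine hmono.congr ?_
    intro p hp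
    have hp0 := hp.1
    have a1 : (q*Γ2 + 1) ≠ 0 := by positivity
    have a2 : (p*Γ2 + 1) ≠ 0 := by positivity
    simp only [Real.log_div a1 a2]
  exact ⟨hM, fun p hp => hM hp ⟨by positivity, le_rfl⟩ hp.2⟩
end

section
/- Let M ≥ 1, B > 0, and for each m let Γ1(m) > Γ2(m) > 0 and weights W1(m), W2(m) > 0 with W1(m) < W2(m) and W2(m)·Γ2(m) < W1(m)·Γ1(m); set Ω(m) = (W2(m)·Γ2(m) − W1(m)·Γ1(m))/(Γ1(m)·Γ2(m)·(W1(m) − W2(m))). Let Θ : Fin M → ℝ with Θ(m) > 2·Ω(m) for all m, and let P ≥ ∑_m Θ(m). Let λ > 0 and define q*(m) = max(Θ(m), W2(m)·B/λ − 1/Γ2(m)), and assume ∑_m q*(m) = P. Then for every q : Fin M → ℝ with q(m) ≥ Θ(m) for all m and ∑_m q(m) ≤ P, one has ∑_m f_m(q(m)) ≤ ∑_m f_m(q*(m)), where f_m(q) = W1(m)·B·log(1 + Ω(m)·Γ1(m)) + W2(m)·B·log((q·Γ2(m) + 1)/(Ω(m)·Γ2(m) + 1)). -/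
/-- Waterfilling budgets q* solve the weighted-sum-rate channel power-budget problem. -/
theorem stmt_10 (M : ℕ) (hM : 1 ≤ M) (B P lam : ℝ) (hB : 0 < B) (hlam : 0 < lam)
    (Γ1 Γ2 W1 W2 Ω Θ : Fin M → ℝ)
    (hΓ : ∀ m, 0 < Γ2 m ∧ Γ2 m < Γ1 m)
    (hW : ∀ m, 0 < W1 m ∧ 0 < W2 m ∧ W1 m < W2 m ∧ W2 m * Γ2 m < W1 m * Γ1 m)
    (hΩ : ∀ m, Ω m = (W2 m * Γ2 m - W1 m * Γ1 m) / (Γ1 m * Γ2 m * (W1 m - W2 m)))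
    (hΘ : ∀ m, 2 * Ω m < Θ m) (hP : ∑ m, Θ m ≤ P)
    (qs : Fin M → ℝ)
    (hqs : ∀ m, qs m = max (Θ m) (W2 m * B / lam - 1 / Γ2 m))
    (hsum : ∑ m, qs m = P) :
    ∀ q : Fin M → ℝ, (∀ m, Θ m ≤ q m) → (∑ m, q m ≤ P) →
      (∑ m, (W1 m * B * Real.log (1 + Ω m * Γ1 m) +
        W2 m * B * Real.log ((q m * Γ2 m + 1)/(Ω m * Γ2 m + 1)))) ≤
      (∑ m, (W1 m * B * Real.log (1 + Ω m * Γ1 m) +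
        W2 m * B * Real.log ((qs m * Γ2 m + 1)/(Ω m * Γ2 m + 1)))) := by
  intro q hq hqP
  have key : ∀ m, W1 m * B * Real.log (1 + Ω m * Γ1 m) +
        W2 m * B * Real.log ((q m * Γ2 m + 1)/(Ω m * Γ2 m + 1)) ≤
      (W1 m * B * Real.log (1 + Ω m * Γ1 m) +
        W2 m * B * Real.log ((qs m * Γ2 m + 1)/(Ω m * Γ2 m + 1))) + lam * (q m - qs m) := by
    intro m
    obtain ⟨hg2, hg⟩ := hΓ m
    obtain ⟨hw1, hw2, hw, hww⟩ := hW m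
    have hg1 : 0 < Γ1 m := hg2.trans hg
    have hO : 0 < Ω m := by
      rw [hΩ m]
      exact div_pos_of_neg_of_neg (by linarith)
        (mul_neg_of_pos_of_neg (mul_pos hg1 hg2) (by linarith))
    have hT : 0 < Θ m := by linarith [hΘ m]
    have hqp : 0 < q m := hT.trans_le (hq m)
    have hqs1 : Θ m ≤ qs m := by rw [hqs m]; exact le_max_left _ _
    have hqsp : 0 < qs m := hT.trans_le hqs1
    have ha : 0 < q m * Γ2 m + 1 := by positivity
    have hb : 0 < qs m * Γ2 m + 1 := by positivity
    have hc : 0 < Ω m * Γ2 m + 1 := by positivity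
    rw [Real.log_div ha.ne' hc.ne', Real.log_div hb.ne' hc.ne']
    have hlog := Real.log_le_sub_one_of_pos (div_pos ha hb)
    rw [Real.log_div ha.ne' hb.ne'] at hlog
    have hwf : lam * ((W2 m * B / lam - 1 / Γ2 m) * Γ2 m + 1) = W2 m * B * Γ2 m := by
      field_simp
      ring
    have hkt : W2 m * B * Γ2 m * (q m - qs m) ≤ lam * (qs m * Γ2 m + 1) * (q m - qs m) := by
      rcases le_total (Θ m) (W2 m * B / lam - 1 / Γ2 m) with h | h
      · have he : qs m = W2 m * B / lam - 1 / Γ2 m := by rw [hqs m, max_eq_right h]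
        rw [← he] at hwf
        rw [hwf]
      · have he : qs m = Θ m := by rw [hqs m, max_eq_left h]
        apply mul_le_mul_of_nonneg_right _ (by linarith [hq m])
        rw [← hwf, he]
        gcongr
    have h2 : W2 m * B * ((q m * Γ2 m + 1) / (qs m * Γ2 m + 1) - 1) ≤ lam * (q m - qs m) := by
      have : W2 m * B * ((q m * Γ2 m + 1) / (qs m * Γ2 m + 1) - 1)
          = W2 m * B * Γ2 m * (q m - qs m) / (qs m * Γ2 m + 1) := by
        field_simp
        ring
      rw [this, div_le_iff₀ hb]
      linarith
    have h3 := mul_le_mul_of_nonneg_left hlog (mul_pos hw2 hB).le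
    linarith
  have hs := Finset.sum_le_sum (fun m (_ : m ∈ Finset.univ) => key m)
  rw [Finset.sum_add_distrib (g := fun m => lam * (q m - qs m)), ← Finset.mul_sum,
    Finset.sum_sub_distrib, hsum] at hs
  have : lam * (∑ m, q m - P) ≤ 0 := mul_nonpos_of_nonneg_of_nonpos hlam.le (by linarith)
  linarith
end

section
/- Let B > 0, Γ1 ≥ Γ2 > 0, A1 ≥ 1, A2 ≥ 2, and let q ≥ Υ where Υ = A2·(A1 − 1)/Γ1 + (A2 − 1)/Γ2; set Ξ = (Γ2·q − A2 + 1)/(A2·Γ2). Then Ξ belongs to the feasible set S = {p : 0 ≤ p ≤ q/2, 1 + p·Γ1 ≥ A1, (q·Γ2 + 1)/(p·Γ2 + 1) ≥ A2}, and for every p ∈ S, T(p) ≤ T(Ξ), where T(p) = B·log(1 + p·Γ1) + B·log((q·Γ2 + 1)/(p·Γ2 + 1)); i.e., p1 = Ξ, p2 = q − Ξ maximizes the sum rate subject to the QoS and power-order constraints. -/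
/-- Sum rate with QoS on one channel: Ξ is feasible and maximizes T over the feasible set. -/
theorem stmt_13 (B Γ1 Γ2 A1 A2 q Υ Ξ : ℝ) (hB : 0 < B) (hΓ2 : 0 < Γ2) (hΓ : Γ2 ≤ Γ1)
    (hA1 : 1 ≤ A1) (hA2 : 2 ≤ A2)
    (hΥ : Υ = A2*(A1 - 1)/Γ1 + (A2 - 1)/Γ2) (hq : Υ ≤ q)
    (hΞ : Ξ = (Γ2*q - A2 + 1) / (A2*Γ2)) :
    Ξ ∈ {p : ℝ | 0 ≤ p ∧ p ≤ q/2 ∧ A1 ≤ 1 + p*Γ1 ∧ A2 ≤ (q*Γ2 + 1)/(p*Γ2 + 1)} ∧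
    ∀ p ∈ {p : ℝ | 0 ≤ p ∧ p ≤ q/2 ∧ A1 ≤ 1 + p*Γ1 ∧ A2 ≤ (q*Γ2 + 1)/(p*Γ2 + 1)},
      B * Real.log (1 + p*Γ1) + B * Real.log ((q*Γ2 + 1)/(p*Γ2 + 1)) ≤
      B * Real.log (1 + Ξ*Γ1) + B * Real.log ((q*Γ2 + 1)/(Ξ*Γ2 + 1)) := by
  have hΓ1 : 0 < Γ1 := lt_of_lt_of_le hΓ2 hΓ
  have hA : 0 < A2 := by linarith
  have key : A2 * (Ξ*Γ2 + 1) = q*Γ2 + 1 := by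
    rw [hΞ]; field_simp; ring
  have hqe : q = A2*Ξ + (A2 - 1)/Γ2 := by
    field_simp; linarith
  have h1 : (A1 - 1)/Γ1 ≤ Ξ := by
    have h2 : A2 * ((A1 - 1)/Γ1) ≤ A2 * Ξ := by
      rw [← mul_div_assoc]; linarith
    exact le_of_mul_le_mul_left h2 hA
  have h0 : 0 ≤ Ξ := le_trans (div_nonneg (by linarith) hΓ1.le) h1
  have hd : 0 < Ξ*Γ2 + 1 := by positivity
  have hqp : 0 < q*Γ2 + 1 := by rw [← key]; positivity
  refine ⟨⟨h0, ?_, ?_, ?_⟩, ?_⟩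
  · have : 0 ≤ (A2 - 1)/Γ2 := div_nonneg (by linarith) hΓ2.le
    nlinarith
  · rw [div_le_iff₀ hΓ1] at h1; linarith
  · rw [le_div_iff₀ hd]; exact key.le
  · rintro p ⟨hp0, -, -, hp⟩
    have hpd : 0 < p*Γ2 + 1 := by positivity
    rw [le_div_iff₀ hpd, ← key] at hp
    have hle : p ≤ Ξ := by
      have h3 := le_of_mul_le_mul_left hp hA
      exact le_of_mul_le_mul_right (by linarith) hΓ2
    have hp1 : 0 < 1 + p*Γ1 := by positivity
    have hx1 : 0 < 1 + Ξ*Γ1 := by positivity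
    rw [← mul_add, ← mul_add, ← Real.log_mul hp1.ne' (div_pos hqp hpd).ne',
      ← Real.log_mul hx1.ne' (div_pos hqp hd).ne']
    apply mul_le_mul_of_nonneg_left _ hB.le
    apply Real.log_le_log (mul_pos hp1 (div_pos hqp hpd))
    rw [← mul_div_assoc, ← mul_div_assoc, div_le_div_iff₀ hpd hd]
    have h4 : (1 + p*Γ1) * (Ξ*Γ2 + 1) ≤ (1 + Ξ*Γ1) * (p*Γ2 + 1) := by
      nlinarith [mul_nonneg (sub_nonneg.2 hle) (sub_nonneg.2 hΓ)]
    have h5 := mul_le_mul_of_nonneg_left h4 hqp.le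
    linarith
end

section
/- Let M ≥ 1, B > 0, and for each m let Γ1(m) ≥ Γ2(m) > 0, A1(m) ≥ 1, A2(m) ≥ 2; set Υ(m) = A2(m)·(A1(m) − 1)/Γ1(m) + (A2(m) − 1)/Γ2(m) and let P ≥ ∑_m Υ(m). Let λ > 0 and define q*(m) = max(Υ(m), B/λ − A2(m)/Γ1(m) + A2(m)/Γ2(m) − 1/Γ2(m)), and assume ∑_m q*(m) = P. Then for every q : Fin M → ℝ with q(m) ≥ Υ(m) for all m and ∑_m q(m) ≤ P, one has ∑_m w_m(q(m)) ≤ ∑_m w_m(q*(m)), where w_m(q) = B·log((A2(m)·Γ2(m) − A2(m)·Γ1(m) + Γ1(m)·Γ2(m)·q + Γ1(m))/(A2(m)·Γ2(m))). -/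
/-- Waterfilling budgets q* solve the QoS-constrained sum-rate power-budget problem. -/
theorem stmt_16 (M : ℕ) (hM : 1 ≤ M) (B P lam : ℝ) (hB : 0 < B) (hlam : 0 < lam)
    (Γ1 Γ2 A1 A2 Υ : Fin M → ℝ)
    (hΓ : ∀ m, 0 < Γ2 m ∧ Γ2 m ≤ Γ1 m)
    (hA1 : ∀ m, 1 ≤ A1 m) (hA2 : ∀ m, 2 ≤ A2 m)
    (hΥ : ∀ m, Υ m = A2 m * (A1 m - 1)/Γ1 m + (A2 m - 1)/Γ2 m)
    (hP : ∑ m, Υ m ≤ P)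
    (qs : Fin M → ℝ)
    (hqs : ∀ m, qs m = max (Υ m) (B/lam - A2 m / Γ1 m + A2 m / Γ2 m - 1/Γ2 m))
    (hsum : ∑ m, qs m = P) :
    ∀ q : Fin M → ℝ, (∀ m, Υ m ≤ q m) → (∑ m, q m ≤ P) →
      (∑ m, B * Real.log ((A2 m * Γ2 m - A2 m * Γ1 m + Γ1 m * Γ2 m * q m + Γ1 m)
          / (A2 m * Γ2 m))) ≤
      (∑ m, B * Real.log ((A2 m * Γ2 m - A2 m * Γ1 m + Γ1 m * Γ2 m * qs m + Γ1 m)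
          / (A2 m * Γ2 m))) := by
  intro q hq hqP
  have key : ∀ m, B * Real.log ((A2 m * Γ2 m - A2 m * Γ1 m + Γ1 m * Γ2 m * q m + Γ1 m)
          / (A2 m * Γ2 m)) ≤
      B * Real.log ((A2 m * Γ2 m - A2 m * Γ1 m + Γ1 m * Γ2 m * qs m + Γ1 m)
          / (A2 m * Γ2 m)) + lam * (q m - qs m) := by
    intro m
    obtain ⟨h2, h21⟩ := hΓ m
    have h1 : 0 < Γ1 m := h2.trans_le h21
    have ha1 : 0 < A1 m := by linarith [hA1 m]
    have ha2 : 0 < A2 m := by linarith [hA2 m]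
    obtain ⟨c, hc⟩ : ∃ c, c = A2 m / Γ1 m - A2 m / Γ2 m + 1 / Γ2 m := ⟨_, rfl⟩
    have hX : ∀ x, (A2 m * Γ2 m - A2 m * Γ1 m + Γ1 m * Γ2 m * x + Γ1 m) / (A2 m * Γ2 m)
        = Γ1 m / A2 m * (x + c) := by
      intro x
      rw [hc]
      field_simp
      ring
    have hU : Υ m + c = A2 m * A1 m / Γ1 m := by
      rw [hc, hΥ m]
      field_simp
      ring
    have hUpos : 0 < Υ m + c := by rw [hU]; positivity
    have hqc : 0 < q m + c := by linarith [hq m]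
    have hs1 : Υ m ≤ qs m := by rw [hqs m]; exact le_max_left _ _
    have hs2 : B / lam - c ≤ qs m := by
      rw [hqs m]
      refine le_trans (le_of_eq ?_) (le_max_right _ _)
      rw [hc]; ring
    have hsc : 0 < qs m + c := by linarith
    have hs3 : qs m = Υ m ∨ qs m + c = B / lam := by
      rcases max_choice (Υ m) (B/lam - A2 m / Γ1 m + A2 m / Γ2 m - 1/Γ2 m) with h | h
      · left; rw [hqs m, h]
      · right; rw [hqs m, h, hc]; ring
    have hk : 0 < Γ1 m / A2 m := by positivity
    rw [hX, hX, Real.log_mul hk.ne' hqc.ne', Real.log_mul hk.ne' hsc.ne']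
    have hl : Real.log (q m + c) - Real.log (qs m + c) ≤ (q m - qs m) / (qs m + c) := by
      rw [← Real.log_div hqc.ne' hsc.ne']
      refine (Real.log_le_sub_one_of_pos (div_pos hqc hsc)).trans (le_of_eq ?_)
      field_simp
      ring
    have hf : B * ((q m - qs m) / (qs m + c)) ≤ lam * (q m - qs m) := by
      rcases hs3 with h | h
      · have hb : B ≤ lam * (qs m + c) := by
          have : B / lam ≤ qs m + c := by linarith
          rw [div_le_iff₀ hlam] at this
          linarith
        have hd : 0 ≤ q m - qs m := by rw [h]; linarith [hq m]
        rw [← mul_div_assoc, div_le_iff₀ hsc]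
        nlinarith [mul_le_mul_of_nonneg_right hb hd]
      · rw [h]
        apply le_of_eq
        field_simp
    nlinarith [mul_le_mul_of_nonneg_left hl hB.le]
  have hsumkey := Finset.sum_le_sum (s := Finset.univ) fun m _ => key m
  rw [Finset.sum_add_distrib, ← Finset.mul_sum _ _ lam, Finset.sum_sub_distrib] at hsumkey
  have : lam * (∑ m, q m - ∑ m, qs m) ≤ 0 :=
    mul_nonpos_of_nonneg_of_nonpos hlam.le (by linarith)
  linarith
end

section
/- Let S be a set in a type α, let f, g : α → ℝ with g(x) > 0 for all x ∈ S, and let c ∈ ℝ. Suppose x* ∈ S satisfies f(x) − c·g(x) ≤ f(x*) − c·g(x*) for all x ∈ S (i.e., x* maximizes the parameterized objective over S) and f(x*) − c·g(x*) = 0. Then x* maximizes the fractional objective: f(x)/g(x) ≤ f(x*)/g(x*) for all x ∈ S. -/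
/-- Dinkelbach's principle: a zero-value maximizer of f − c·g maximizes f/g. -/
theorem stmt_17 {α : Type*} (S : Set α) (f g : α → ℝ) (c : ℝ)
    (hg : ∀ x ∈ S, 0 < g x) (x0 : α) (hx0 : x0 ∈ S)
    (hmax : ∀ x ∈ S, f x - c * g x ≤ f x0 - c * g x0)
    (hzero : f x0 - c * g x0 = 0) :
    ∀ x ∈ S, f x / g x ≤ f x0 / g x0 := by
  intro x hx
  have h0 : f x0 / g x0 = c := by
    rw [div_eq_iff (hg x0 hx0).ne']
    linarith
  rw [h0, div_le_iff₀ (hg x hx)]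
  have h1 := hmax x hx
  linarith
end

section
/- Let M ≥ 1, B > 0, P_T ≥ 0, and for each m let Γ1(m) > Γ2(m) > 0 and weights W1(m), W2(m) > 0 with W1(m) < W2(m) and W2(m)·Γ2(m) < W1(m)·Γ1(m); set Ω(m) = (W2(m)·Γ2(m) − W1(m)·Γ1(m))/(Γ1(m)·Γ2(m)·(W1(m) − W2(m))). Let Θ : Fin M → ℝ with Θ(m) > 2·Ω(m) for all m and P ≥ ∑_m Θ(m). Let α > 0 and λ ≥ 0, define q*(m) = max(Θ(m), W2(m)·B/(α + λ) − 1/Γ2(m)), and assume ∑_m q*(m) = P. Then for every q : Fin M → ℝ with q(m) ≥ Θ(m) for all m and ∑_m q(m) ≤ P, one has H(q) ≤ H(q*), where H(q) = ∑_m [W1(m)·B·log(1 + Ω(m)·Γ1(m)) + W2(m)·B·log((q(m)·Γ2(m) + 1)/(Ω(m)·Γ2(m) + 1))] − α·(P_T + ∑_m q(m)). -/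
/-- Dinkelbach subproblem for weighted EE: q* maximizes H over the feasible set. -/
theorem stmt_18 (M : ℕ) (hM : 1 ≤ M) (B PT P alpha lam : ℝ)
    (hB : 0 < B) (hPT : 0 ≤ PT) (halpha : 0 < alpha) (hlam : 0 ≤ lam)
    (Γ1 Γ2 W1 W2 Ω Θ : Fin M → ℝ)
    (hΓ : ∀ m, 0 < Γ2 m ∧ Γ2 m < Γ1 m)
    (hW : ∀ m, 0 < W1 m ∧ 0 < W2 m ∧ W1 m < W2 m ∧ W2 m * Γ2 m < W1 m * Γ1 m)
    (hΩ : ∀ m, Ω m = (W2 m * Γ2 m - W1 m * Γ1 m) / (Γ1 m * Γ2 m * (W1 m - W2 m)))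
    (hΘ : ∀ m, 2 * Ω m < Θ m) (hP : ∑ m, Θ m ≤ P)
    (qs : Fin M → ℝ)
    (hqs : ∀ m, qs m = max (Θ m) (W2 m * B / (alpha + lam) - 1 / Γ2 m))
    (hsum : ∑ m, qs m = P) :
    ∀ q : Fin M → ℝ, (∀ m, Θ m ≤ q m) → (∑ m, q m ≤ P) →
      ((∑ m, (W1 m * B * Real.log (1 + Ω m * Γ1 m) +
          W2 m * B * Real.log ((q m * Γ2 m + 1)/(Ω m * Γ2 m + 1))))
        - alpha * (PT + ∑ m, q m)) ≤
      ((∑ m, (W1 m * B * Real.log (1 + Ω m * Γ1 m) +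
          W2 m * B * Real.log ((qs m * Γ2 m + 1)/(Ω m * Γ2 m + 1))))
        - alpha * (PT + ∑ m, qs m)) := by
  intro q hq hqP
  have hs : 0 < alpha + lam := by linarith
  have key : ∀ m, (W1 m * B * Real.log (1 + Ω m * Γ1 m) +
          W2 m * B * Real.log ((q m * Γ2 m + 1)/(Ω m * Γ2 m + 1))) ≤
        (W1 m * B * Real.log (1 + Ω m * Γ1 m) +
          W2 m * B * Real.log ((qs m * Γ2 m + 1)/(Ω m * Γ2 m + 1)))
        + (alpha + lam) * (q m - qs m) := by
    intro m
    obtain ⟨hg2, hg⟩ := hΓ m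
    obtain ⟨hw1, hw2, hw, hwg⟩ := hW m
    have hO : 0 < Ω m := by
      rw [hΩ m]
      apply div_pos_of_neg_of_neg
      · linarith
      · exact mul_neg_of_pos_of_neg (mul_pos (hg2.trans hg) hg2) (by linarith)
    have hT := hΘ m
    have hqm := hq m
    have hqsT : Θ m ≤ qs m := by rw [hqs m]; exact le_max_left _ _
    have hqsR : W2 m * B / (alpha + lam) - 1 / Γ2 m ≤ qs m := by
      rw [hqs m]; exact le_max_right _ _
    have ha : 0 < q m * Γ2 m + 1 := by
      have : 0 < q m * Γ2 m := mul_pos (by linarith) hg2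
      linarith
    have hb : 0 < qs m * Γ2 m + 1 := by
      have : 0 < qs m * Γ2 m := mul_pos (by linarith) hg2
      linarith
    have hc : 0 < Ω m * Γ2 m + 1 := by
      have : 0 < Ω m * Γ2 m := mul_pos hO hg2
      linarith
    have hlog : Real.log (q m * Γ2 m + 1) - Real.log (qs m * Γ2 m + 1)
        ≤ Γ2 m * (q m - qs m) / (qs m * Γ2 m + 1) := by
      rw [← Real.log_div ha.ne' hb.ne']
      refine (Real.log_le_sub_one_of_pos (div_pos ha hb)).trans (le_of_eq ?_)
      rw [div_sub_one hb.ne']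
      ring
    have hid : (W2 m * B / (alpha + lam) - 1 / Γ2 m) * ((alpha + lam) * Γ2 m)
        = W2 m * B * Γ2 m - (alpha + lam) := by
      field_simp
    have hle : W2 m * B * Γ2 m ≤ (alpha + lam) * (qs m * Γ2 m + 1) := by
      have := mul_le_mul_of_nonneg_right hqsR (mul_pos hs hg2).le
      rw [hid] at this
      linarith
    have hfin : W2 m * B * (Γ2 m * (q m - qs m) / (qs m * Γ2 m + 1))
        ≤ (alpha + lam) * (q m - qs m) := by
      rw [← mul_div_assoc, div_le_iff₀ hb]
      rcases le_or_gt (qs m) (q m) with h | h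
      · have := mul_le_mul_of_nonneg_right hle (sub_nonneg.2 h)
        linarith
      · have heq : qs m = W2 m * B / (alpha + lam) - 1 / Γ2 m := by
          rcases max_choice (Θ m) (W2 m * B / (alpha + lam) - 1 / Γ2 m) with h' | h'
          · rw [← hqs m] at h'
            linarith
          · rw [hqs m, h']
        rw [← heq] at hid
        have : W2 m * B * Γ2 m = (alpha + lam) * (qs m * Γ2 m + 1) := by linarith
        apply le_of_eq
        linear_combination (q m - qs m) * this
    rw [Real.log_div ha.ne' hc.ne', Real.log_div hb.ne' hc.ne']
    have := mul_le_mul_of_nonneg_left hlog (mul_pos hw2 hB).le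
    linarith
  have hS := Finset.sum_le_sum (fun m (_ : m ∈ Finset.univ) => key m)
  rw [Finset.sum_add_distrib (g := fun m => (alpha + lam) * (q m - qs m)), ← Finset.mul_sum,
    Finset.sum_sub_distrib] at hS
  have hl : lam * (∑ m, q m - ∑ m, qs m) ≤ 0 :=
    mul_nonpos_of_nonneg_of_nonpos hlam (by linarith)
  linarith
end

section
/- Let M ≥ 1, B > 0, P_T ≥ 0, and for each m let Γ1(m) ≥ Γ2(m) > 0, A1(m) ≥ 1, A2(m) ≥ 2; set Υ(m) = A2(m)·(A1(m) − 1)/Γ1(m) + (A2(m) − 1)/Γ2(m) and let P ≥ ∑_m Υ(m). Let α > 0 and λ ≥ 0, define q*(m) = max(Υ(m), B/(λ + α) − A2(m)/Γ1(m) + A2(m)/Γ2(m) − 1/Γ2(m)), and assume ∑_m q*(m) = P. Then for every q : Fin M → ℝ with q(m) ≥ Υ(m) for all m and ∑_m q(m) ≤ P, one has Q(q) ≤ Q(q*), where Q(q) = ∑_m w_m(q(m)) − α·(P_T + ∑_m q(m)) and w_m(q) = B·log((A2(m)·Γ2(m) − A2(m)·Γ1(m) + Γ1(m)·Γ2(m)·q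 + Γ1(m))/(A2(m)·Γ2(m))). -/
/-- Per-channel inequality: q* maximizes the Lagrangian term of a channel. -/
lemma channel_aux (B mu g1 g2 a1 a2 u q s : ℝ) (hB : 0 < B) (hmu : 0 < mu) (h2 : 0 < g2)
    (h1 : 0 < g1) (ha1 : 1 ≤ a1) (ha2 : 2 ≤ a2)
    (hu : u = a2 * (a1 - 1)/g1 + (a2 - 1)/g2)
    (hs : s = max u (B/mu - a2 / g1 + a2 / g2 - 1/g2)) (hq : u ≤ q) :
    B * Real.log ((a2 * g2 - a2 * g1 + g1 * g2 * q + g1) / (a2 * g2)) - mu * q ≤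
    B * Real.log ((a2 * g2 - a2 * g1 + g1 * g2 * s + g1) / (a2 * g2)) - mu * s := by
  obtain ⟨c, hc⟩ : ∃ c, c = a2 / g1 - a2 / g2 + 1 / g2 := ⟨_, rfl⟩
  have ha2p : 0 < a2 := by linarith
  have hN : ∀ x, (a2 * g2 - a2 * g1 + g1 * g2 * x + g1) / (a2 * g2) = (g1 / a2) * (x + c) := by
    intro x
    rw [hc]
    field_simp
    ring
  have huc : 0 < u + c := by
    have : u + c = a2 * a1 / g1 := by
      rw [hu, hc]
      field_simp
      ring
    rw [this]
    have : 0 < a1 := by linarith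
    positivity
  have hus : u ≤ s := hs ▸ le_max_left _ _
  have hqc : 0 < q + c := by linarith
  have hsc : 0 < s + c := by linarith
  have key : (q - s) * (B - mu * (s + c)) ≤ 0 := by
    rcases max_cases u (B/mu - a2 / g1 + a2 / g2 - 1/g2) with ⟨h, h'⟩ | ⟨h, h'⟩
    · rw [h] at hs
      have h3 : B / mu ≤ s + c := by rw [hs, hc]; linarith
      rw [div_le_iff₀ hmu] at h3
      exact mul_nonpos_of_nonneg_of_nonpos (by linarith) (by linarith)
    · rw [h] at hs
      have h3 : s + c = B / mu := by rw [hs, hc]; ring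
      have h4 : B - mu * (s + c) = 0 := by
        rw [h3]
        field_simp
        ring
      rw [h4]
      simp
  have hg : g1 / a2 ≠ 0 := by positivity
  rw [hN, hN, Real.log_mul hg hqc.ne', Real.log_mul hg hsc.ne']
  have hl := Real.log_le_sub_one_of_pos (div_pos hqc hsc)
  rw [Real.log_div hqc.ne' hsc.ne'] at hl
  have h5 : B * ((q + c) / (s + c) - 1) ≤ mu * (q - s) := by
    have : B * ((q + c) / (s + c) - 1) = B * (q - s) / (s + c) := by
      field_simp
      ring
    rw [this, div_le_iff₀ hsc]
    linarith
  have h6 := mul_le_mul_of_nonneg_left hl hB.le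
  linarith

/-- Dinkelbach subproblem for QoS-constrained EE: q* maximizes Q over the feasible set. -/
theorem stmt_19 (M : ℕ) (hM : 1 ≤ M) (B PT P alpha lam : ℝ)
    (hB : 0 < B) (hPT : 0 ≤ PT) (halpha : 0 < alpha) (hlam : 0 ≤ lam)
    (Γ1 Γ2 A1 A2 Υ : Fin M → ℝ)
    (hΓ : ∀ m, 0 < Γ2 m ∧ Γ2 m ≤ Γ1 m)
    (hA1 : ∀ m, 1 ≤ A1 m) (hA2 : ∀ m, 2 ≤ A2 m)
    (hΥ : ∀ m, Υ m = A2 m * (A1 m - 1)/Γ1 m + (A2 m - 1)/Γ2 m)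
    (hP : ∑ m, Υ m ≤ P)
    (qs : Fin M → ℝ)
    (hqs : ∀ m, qs m = max (Υ m) (B/(lam + alpha) - A2 m / Γ1 m + A2 m / Γ2 m - 1/Γ2 m))
    (hsum : ∑ m, qs m = P) :
    ∀ q : Fin M → ℝ, (∀ m, Υ m ≤ q m) → (∑ m, q m ≤ P) →
      ((∑ m, B * Real.log ((A2 m * Γ2 m - A2 m * Γ1 m + Γ1 m * Γ2 m * q m + Γ1 m)
          / (A2 m * Γ2 m))) - alpha * (PT + ∑ m, q m)) ≤
      ((∑ m, B * Real.log ((A2 m * Γ2 m - A2 m * Γ1 m + Γ1 m * Γ2 m * qs m + Γ1 m)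
          / (A2 m * Γ2 m))) - alpha * (PT + ∑ m, qs m)) := by
  intro q hq hqP
  have h := Finset.sum_le_sum (s := Finset.univ) fun m _ =>
    channel_aux B (lam + alpha) (Γ1 m) (Γ2 m) (A1 m) (A2 m) (Υ m) (q m) (qs m) hB (by linarith)
      (hΓ m).1 (lt_of_lt_of_le (hΓ m).1 (hΓ m).2) (hA1 m) (hA2 m) (hΥ m) (hqs m) (hq m)
  rw [Finset.sum_sub_distrib, Finset.sum_sub_distrib, ← Finset.mul_sum Finset.univ q,
    ← Finset.mul_sum Finset.univ qs] at h
  have h2 : lam * ∑ m, q m ≤ lam * ∑ m, qs m :=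
    mul_le_mul_of_nonneg_left (hsum ▸ hqP) hlam
  linarith
end
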